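/- Let m, n be positive integers and let A ∈ M_{m,n}(ℝ) be badly approximable. Then for any decreasing function ψ : ℝ⁺ → ℝ⁺, the Lebesgue measure of W_A(ψ) equals 0 if ∑_{q=1}^∞ q^{n-1} ψ(q)^m < ∞, and equals 1 if ∑_{q=1}^∞ q^{n-1} ψ(q)^m = ∞. -/

import Mathlib

open MeasureTheory Filter

/-- Distance from `x ∈ ℝ^k` to the nearest integer vector, in the sup norm. -/
noncomputable def intDist {k : ℕ} (x : Fin k → ℝ) : ℝ :=
  ⨅ p : Fin k → ℤ, ‖x - (fun i => (p i : ℝ))‖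

/-- The set `W_A(ψ)` of `ψ`-approximable targets `b ∈ [0,1]^m` for `A`. -/
noncomputable def WA (m n : ℕ) (A : Matrix (Fin m) (Fin n) ℝ) (ψ : ℝ → ℝ) :
    Set (Fin m → ℝ) :=
  {b | b ∈ Set.Icc (0 : Fin m → ℝ) 1 ∧
    {q : Fin n → ℤ |
      intDist (A.mulVec (fun j => (q j : ℝ)) - b) < ψ ‖(fun j => (q j : ℝ))‖}.Infinite}

/-- `A` is badly approximable: `liminf_{‖q‖ → ∞} ‖q‖^{n/m} ‖Aq‖_ℤ > 0`.  On `ℤ^n`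
the filter `‖q‖ → ∞` coincides with the cofinite filter. -/
def BadlyApproximable (m n : ℕ) (A : Matrix (Fin m) (Fin n) ℝ) : Prop :=
  0 < Filter.liminf (fun q : Fin n → ℤ =>
    ‖(fun j => (q j : ℝ))‖ ^ ((n : ℝ) / m) * intDist (A.mulVec (fun j => (q j : ℝ))))
    Filter.cofinite

section RealSums

theorem exists_pos_pow_eq {m : ℕ} (hm : 0 < m) {x : ℝ} (hx : 0 < x) : ∃ d : ℝ, 0 < d ∧ d ^ m = x :=
  ⟨x ^ ((m : ℝ)⁻¹), Real.rpow_pos_of_pos hx _, Real.rpow_inv_natCast_pow hx.le hm.ne'⟩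

/-- Condensation along powers of two for series `∑ j ^ d * f j` with `f` antitone. -/
theorem summable_pow_mul_of_summable_condensed {d : ℕ} {f : ℕ → ℝ} (hf0 : ∀ j, 0 < j → 0 ≤ f j)
    (hf : ∀ i j, 0 < i → i ≤ j → f j ≤ f i)
    (hs : Summable fun k : ℕ => (2 : ℝ) ^ (k * (d + 1)) * f (2 ^ k)) :
    Summable fun j : ℕ => ((j : ℝ) + 1) ^ d * f (j + 1) := by
  have key : ∀ K : ℕ, ∑ j ∈ Finset.Ico 1 (2 ^ K : ℕ), (j : ℝ) ^ d * f j ≤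
      ∑ k ∈ Finset.range K, 2 ^ d * ((2 : ℝ) ^ (k * (d + 1)) * f (2 ^ k)) := by
    intro K
    induction K with
    | zero => simp
    | succ K ih =>
      rw [Finset.sum_range_succ, ← Finset.sum_Ico_consecutive _ (Nat.one_le_two_pow (n := K))
        (Nat.pow_le_pow_right two_pos K.le_succ)]
      refine add_le_add ih ?_
      have : ∀ j ∈ Finset.Ico (2 ^ K : ℕ) (2 ^ (K + 1)),
          (j : ℝ) ^ d * f j ≤ (2 ^ (K + 1)) ^ d * f (2 ^ K) := by
        intro j hj
        rw [Finset.mem_Ico] at hj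
        have h2 : (j : ℝ) ≤ 2 ^ (K + 1) := by exact_mod_cast hj.2.le
        have hp : 0 < 2 ^ K := by positivity
        have := hf0 j (by omega)
        have := hf _ _ hp hj.1
        gcongr
      refine (Finset.sum_le_card_nsmul _ _ _ this).trans (le_of_eq ?_)
      rw [Nat.card_Ico, nsmul_eq_mul]
      have : 2 ^ (K + 1) - 2 ^ K = 2 ^ K := by rw [pow_succ]; omega
      rw [this]
      push_cast
      ring
  have hterm : ∀ j : ℕ, 0 ≤ ((j : ℝ) + 1) ^ d * f (j + 1) := fun j =>
    mul_nonneg (by positivity) (hf0 _ j.succ_pos)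
  refine summable_of_sum_range_le (c := ∑' k, 2 ^ d * ((2 : ℝ) ^ (k * (d + 1)) * f (2 ^ k)))
    hterm fun N => ?_
  calc ∑ j ∈ Finset.range N, ((j : ℝ) + 1) ^ d * f (j + 1)
      = ∑ j ∈ Finset.Ico 1 (N + 1), (j : ℝ) ^ d * f j := by
        rw [Finset.sum_Ico_eq_sum_range]
        simp [add_comm]
    _ ≤ ∑ j ∈ Finset.Ico 1 (2 ^ (N + 1) : ℕ), (j : ℝ) ^ d * f j := by
        refine Finset.sum_le_sum_of_subset_of_nonneg
          (Finset.Ico_subset_Ico_right Nat.lt_two_pow_self.le) fun j hj _ => ?_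
        exact mul_nonneg (by positivity) (hf0 _ (Finset.mem_Ico.1 hj).1)
    _ ≤ _ := key _
    _ ≤ _ := (hs.mul_left _).sum_le_tsum _ fun k _ =>
        mul_nonneg (by positivity) (mul_nonneg (by positivity) (hf0 _ (by positivity)))

theorem not_summable_min {a : ℕ → ℝ} {e : ℝ} (he : 0 < e) (ha : ¬ Summable a) :
    ¬ Summable fun k => min (a k) e := by
  intro h
  refine ha (h.congr_atTop ?_)
  filter_upwards [h.tendsto_atTop_zero.eventually_lt_const he] with k hk
  rcases min_lt_iff.1 hk with h | h
  · exact min_eq_left h.le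
  · exact absurd h (lt_irrefl _)

theorem exists_one_le_sum_Ico {s : ℕ → ℝ} (hs0 : ∀ k, 0 ≤ s k) (hs : ¬ Summable s) (M : ℕ) :
    ∃ N, 1 ≤ ∑ k ∈ Finset.Ico M N, s k := by
  have h := (not_summable_iff_tendsto_nat_atTop_of_nonneg hs0).1 hs
  obtain ⟨N, hN, hMN⟩ := ((h.eventually_ge_atTop (1 + ∑ k ∈ Finset.range M, s k)).and
    (eventually_ge_atTop M)).exists
  refine ⟨N, ?_⟩
  rw [Finset.sum_Ico_eq_sub _ hMN]
  linarith

theorem sum_sum_geometric_le (I : Finset ℕ) {s : ℕ → ℝ} (hs0 : ∀ k, 0 ≤ s k) :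
    ∑ k ∈ I, ∑ l ∈ I, (if k ≤ l then (1 / 2 : ℝ) ^ (l - k) * s l else 0) ≤ 2 * ∑ l ∈ I, s l := by
  rw [Finset.sum_comm, Finset.mul_sum]
  refine Finset.sum_le_sum fun l _ => ?_
  calc ∑ k ∈ I, (if k ≤ l then (1 / 2 : ℝ) ^ (l - k) * s l else 0)
      = ∑ k ∈ I with k ≤ l, (1 / 2 : ℝ) ^ (l - k) * s l := by rw [Finset.sum_filter]
    _ ≤ ∑ k ∈ Finset.range (l + 1), (1 / 2 : ℝ) ^ (l - k) * s l := by
        refine Finset.sum_le_sum_of_subset_of_nonneg ?_ fun k _ _ =>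
          mul_nonneg (by positivity) (hs0 l)
        intro k hk
        simp only [Finset.mem_filter, Finset.mem_range] at hk ⊢
        omega
    _ = (∑ k ∈ Finset.range (l + 1), (1 / 2 : ℝ) ^ k) * s l := by
        rw [← Finset.sum_mul, ← Finset.sum_range_reflect (fun k => (1 / 2 : ℝ) ^ k)]
        simp
    _ ≤ 2 * s l := mul_le_mul_of_nonneg_right (sum_geometric_two_le _) (hs0 l)

end RealSums

section Abstract

/-- Chung–Erdős inequality. -/
theorem inv_le_measure_biUnion {Ω ι : Type*} [MeasurableSpace Ω] {μ : Measure Ω}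
    [IsFiniteMeasure μ] (I : Finset ι) (F : ι → Set Ω) (hF : ∀ i, MeasurableSet (F i)) {C : ℝ}
    (hC : 0 < C) (hS : 0 < ∑ i ∈ I, μ.real (F i))
    (h : ∑ i ∈ I, ∑ j ∈ I, μ.real (F i ∩ F j) ≤ C * (∑ i ∈ I, μ.real (F i)) ^ 2) :
    C⁻¹ ≤ μ.real (⋃ i ∈ I, F i) := by
  classical
  set S := ∑ i ∈ I, μ.real (F i) with hSdef
  set E := ⋃ i ∈ I, F i with hE
  have hEm : MeasurableSet E := Finset.measurableSet_biUnion _ fun i _ => hF i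
  have hindic : ∀ {A : Set Ω}, MeasurableSet A → Integrable (A.indicator fun _ => (1 : ℝ)) μ :=
    fun hA => (integrable_const 1).indicator hA
  have hval : ∀ {A : Set Ω}, MeasurableSet A → ∫ x, A.indicator (fun _ => (1 : ℝ)) x ∂μ = μ.real A :=
    fun hA => by rw [integral_indicator_const _ hA]; simp
  set t := C * S with ht
  have hpt : ∀ x, 2 * t * ∑ i ∈ I, (F i).indicator (fun _ => (1 : ℝ)) x ≤
      (∑ i ∈ I, ∑ j ∈ I, (F i ∩ F j).indicator (fun _ => (1 : ℝ)) x) +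
        t ^ 2 * E.indicator (fun _ => (1 : ℝ)) x := by
    intro x
    have hmul : ∑ i ∈ I, ∑ j ∈ I, (F i ∩ F j).indicator (fun _ => (1 : ℝ)) x =
        (∑ i ∈ I, (F i).indicator (fun _ => (1 : ℝ)) x) ^ 2 := by
      rw [sq, Finset.sum_mul_sum]
      refine Finset.sum_congr rfl fun i _ => Finset.sum_congr rfl fun j _ => ?_
      simp only [Set.indicator_apply, Set.mem_inter_iff]
      split_ifs <;> simp_all
    rw [hmul]
    by_cases hx : x ∈ E
    · rw [Set.indicator_of_mem hx]
      nlinarith [sq_nonneg ((∑ i ∈ I, (F i).indicator (fun _ => (1 : ℝ)) x) - t)]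
    · have : ∑ i ∈ I, (F i).indicator (fun _ => (1 : ℝ)) x = 0 := by
        refine Finset.sum_eq_zero fun i hi => Set.indicator_of_notMem (fun hxi => hx ?_) _
        exact Set.mem_biUnion hi hxi
      rw [this, Set.indicator_of_notMem hx]
      simp
  have hmono := integral_mono (μ := μ)
    ((integrable_finsetSum I fun i _ => hindic (hF i)).const_mul (2 * t))
    ((integrable_finsetSum I fun i _ => integrable_finsetSum I fun j _ =>
      hindic ((hF i).inter (hF j))).add ((hindic hEm).const_mul (t ^ 2))) hpt
  simp only [Pi.add_apply] at hmono
  rw [integral_const_mul, integral_finsetSum _ fun i _ => hindic (hF i), integral_add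
      (integrable_finsetSum I fun i _ => integrable_finsetSum I fun j _ =>
        hindic ((hF i).inter (hF j))) ((hindic hEm).const_mul (t ^ 2)), integral_const_mul, hval hEm,
      integral_finsetSum _ fun i _ => integrable_finsetSum I fun j _ =>
        hindic ((hF i).inter (hF j))] at hmono
  simp_rw [integral_finsetSum _ fun j _ => hindic ((hF _).inter (hF j)), hval (hF _),
    hval ((hF _).inter (hF _))] at hmono
  rw [← hSdef] at hmono
  have h1 : C * S ^ 2 ≤ C ^ 2 * S ^ 2 * μ.real E := by
    have : t ^ 2 * μ.real E = C ^ 2 * S ^ 2 * μ.real E := by rw [ht]; ring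
    have : 2 * t * S = 2 * (C * S ^ 2) := by rw [ht]; ring
    linarith
  rw [inv_le_iff_one_le_mul₀ hC]
  have h2 : 0 < C * S ^ 2 := by positivity
  refine le_of_mul_le_mul_left ?_ h2
  linarith

theorem measure_iInter_pos_of_antitone {Ω : Type*} [MeasurableSpace Ω] {μ : Measure Ω}
    [IsFiniteMeasure μ] {E : ℕ → Set Ω} (hE : ∀ k, MeasurableSet (E k)) (hanti : Antitone E)
    {κ : ℝ} (hκ : 0 < κ) (h : ∀ k, κ ≤ μ.real (E k)) : 0 < μ (⋂ k, E k) := by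
  have ht := tendsto_measure_iInter_atTop (μ := μ) (fun k => (hE k).nullMeasurableSet) hanti
    ⟨0, measure_ne_top _ _⟩
  refine lt_of_lt_of_le (ENNReal.ofReal_pos.2 hκ) (ge_of_tendsto' ht fun k => ?_)
  exact ENNReal.ofReal_le_of_le_toReal (h k)

variable {G : Type*} [AddCommGroup G] [TopologicalSpace G] [IsTopologicalAddGroup G]
  [MeasurableSpace G] [BorelSpace G]

theorem ae_mem_of_dense_invariant [SecondCountableTopology G] [R1Space G] {μ : Measure G}
    [IsFiniteMeasure μ]
    [μ.InnerRegular] [μ.IsAddLeftInvariant] {H : Set G} (hH : Dense H) {U : Set G}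
    (hU : MeasurableSet U) (hinv : ∀ g ∈ H, (g + ·) ⁻¹' U = U) (hpos : μ U ≠ 0) :
    ∀ᵐ x ∂μ, x ∈ U := by
  have h := aeconst_of_dense_setOfPred_preimage_vadd_eq (M := G) (μ := μ) hU.nullMeasurableSet
    (hH.mono fun g hg => hinv g hg)
  rcases eventuallyConst_set.1 h with h | h
  · exact h
  · exact absurd (measure_eq_zero_iff_ae_notMem.2 h) hpos

theorem dense_of_measure_closure_pos [LocallyCompactSpace G] [PreconnectedSpace G]
    {μ : Measure G} [μ.IsAddHaarMeasure] [IsFiniteMeasure μ] [μ.InnerRegularCompactLTTop]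
    (H : AddSubgroup G) (h : 0 < μ (closure (H : Set G))) : Dense (H : Set G) := by
  have h1 := Measure.sub_mem_nhds_zero_of_addHaar_pos_ne_top μ (closure (H : Set G))
    isClosed_closure.measurableSet h (measure_ne_top _ _)
  have h2 : (H.topologicalClosure : Set G) ∈ nhds 0 := by
    refine mem_of_superset h1 ?_
    rintro _ ⟨x, hx, y, hy, rfl⟩
    exact H.topologicalClosure.sub_mem hx hy
  have h3 := H.topologicalClosure.isOpen_of_mem_nhds h2
  have h4 : IsClopen (H.topologicalClosure : Set G) := ⟨H.isClosed_topologicalClosure, h3⟩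
  rw [dense_iff_closure_eq]
  exact h4.eq_univ ⟨0, H.topologicalClosure.zero_mem⟩

end Abstract

section Torus

variable {m : ℕ}

theorem volume_real_closedBall_torus (x : UnitAddTorus (Fin m)) {r : ℝ} (h0 : 0 ≤ r)
    (h1 : r ≤ 1 / 2) : volume.real (Metric.closedBall x r) = (2 * r) ^ m := by
  rw [closedBall_pi _ h0, measureReal_def, volume_pi_pi]
  simp only [UnitAddCircle, AddCircle.volume_closedBall]
  rw [min_eq_right (by linarith)]
  simp [h0]

theorem volume_closedBall_torus_le (x : UnitAddTorus (Fin m)) {r : ℝ} (h0 : 0 ≤ r) :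
    volume (Metric.closedBall x r) ≤ ENNReal.ofReal ((2 * r) ^ m) := by
  rw [closedBall_pi _ h0, volume_pi_pi]
  simp only [UnitAddCircle, AddCircle.volume_closedBall]
  rw [ENNReal.ofReal_pow (by positivity)]
  simp only [Finset.prod_const, Finset.card_univ, Fintype.card_fin]
  gcongr
  exact min_le_right _ _

theorem volume_real_closedBall_torus_le (x : UnitAddTorus (Fin m)) {r : ℝ} (h0 : 0 ≤ r) :
    volume.real (Metric.closedBall x r) ≤ (2 * r) ^ m :=
  ENNReal.toReal_le_of_le_ofReal (by positivity) (volume_closedBall_torus_le x h0)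

theorem volume_univ_torus : volume (Set.univ : Set (UnitAddTorus (Fin m))) = 1 := by
  rw [← Set.pi_univ Set.univ, volume_pi_pi]
  simp [UnitAddCircle]

theorem volume_real_biUnion_closedBall {ι : Type*} (I : Finset ι) (x : ι → UnitAddTorus (Fin m))
    {δ : ℝ} (hδ : 0 < δ) (hδ1 : δ ≤ 1)
    (hsep : ∀ i ∈ I, ∀ j ∈ I, i ≠ j → δ ≤ dist (x i) (x j)) :
    volume.real (⋃ i ∈ I, Metric.closedBall (x i) (δ / 3)) = I.card * (2 * (δ / 3)) ^ m := by
  rw [measureReal_biUnion_finset _ fun i _ => Metric.isClosed_closedBall.measurableSet]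
  · simp_rw [volume_real_closedBall_torus _ (by positivity : 0 ≤ δ / 3)
      (by linarith : δ / 3 ≤ 1 / 2)]
    simp
  · intro i hi j hj hij
    refine Metric.closedBall_disjoint_closedBall ?_
    have := hsep i hi j hj hij
    linarith

/-- A packing bound for separated points in a ball of the torus. -/
theorem card_mul_pow_le_of_separated {ι : Type*} (I : Finset ι) (x : ι → UnitAddTorus (Fin m))
    {δ R : ℝ} (hδ : 0 < δ) (hδ1 : δ ≤ 1)
    (hsep : ∀ i ∈ I, ∀ j ∈ I, i ≠ j → δ ≤ dist (x i) (x j)) (hR : 0 ≤ R)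
    (y : UnitAddTorus (Fin m)) (hy : ∀ i ∈ I, dist (x i) y ≤ R) :
    I.card * δ ^ m ≤ 3 ^ m * (R + δ / 3) ^ m := by
  have h1 := volume_real_biUnion_closedBall I x hδ hδ1 hsep
  have h2 : volume.real (⋃ i ∈ I, Metric.closedBall (x i) (δ / 3)) ≤ (2 * (R + δ / 3)) ^ m := by
    refine (measureReal_mono ?_ (measure_ne_top _ _)).trans
      (volume_real_closedBall_torus_le y (by positivity))
    refine Set.iUnion₂_subset fun i hi => Metric.closedBall_subset_closedBall' ?_
    linarith [hy i hi]
  rw [h1] at h2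
  have h3 : (2 * (δ / 3)) ^ m = δ ^ m * (2 / 3) ^ m := by rw [← mul_pow]; ring
  have h4 : (2 * (R + δ / 3)) ^ m = (3 ^ m * (R + δ / 3) ^ m) * (2 / 3) ^ m := by
    rw [← mul_pow, ← mul_pow]; ring
  rw [h3, h4, ← mul_assoc] at h2
  exact le_of_mul_le_mul_right h2 (by positivity)

end Torus

section Box

/-- The box `[0, 2 ^ k) ^ n` of integer vectors. -/
noncomputable def dyadicBox (n k : ℕ) : Finset (Fin n → ℤ) :=
  Fintype.piFinset fun _ => Finset.Ico (0 : ℤ) (2 ^ k)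

theorem card_dyadicBox (n k : ℕ) : (dyadicBox n k).card = (2 ^ k) ^ n := by
  rw [dyadicBox, Fintype.card_piFinset_const, Int.card_Ico, sub_zero]
  norm_cast

theorem norm_sub_le_of_mem_dyadicBox {n k : ℕ} {q q' : Fin n → ℤ} (hq : q ∈ dyadicBox n k)
    (hq' : q' ∈ dyadicBox n k) : ‖q - q'‖ ≤ 2 ^ k := by
  rw [pi_norm_le_iff_of_nonneg (by positivity)]
  intro i
  rw [dyadicBox, Fintype.mem_piFinset] at hq hq'
  have h1 := Finset.mem_Ico.1 (hq i)
  have h2 := Finset.mem_Ico.1 (hq' i)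
  rw [Int.norm_eq_abs]
  have : |(q - q') i| ≤ 2 ^ k := by
    rw [Pi.sub_apply, abs_le]
    constructor <;> linarith
  exact_mod_cast this

theorem norm_le_of_mem_dyadicBox {n k : ℕ} {q : Fin n → ℤ} (hq : q ∈ dyadicBox n k) :
    ‖q‖ ≤ 2 ^ k := by
  simpa using norm_sub_le_of_mem_dyadicBox hq
    (show (0 : Fin n → ℤ) ∈ dyadicBox n k by simp [dyadicBox])

end Box

section Orbit

variable {m n : ℕ} {α : (Fin n → ℤ) →+ UnitAddTorus (Fin m)} {c : ℝ} {δ : ℕ → ℝ}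

theorem le_dist_of_mem_dyadicBox (hα : ∀ q, q ≠ 0 → c ≤ ‖q‖ ^ n * ‖α q‖ ^ m) (hm : 0 < m) {k : ℕ}
    (hδk : δ k ^ m = c / (2 ^ k) ^ n) {q q' : Fin n → ℤ}
    (hq : q ∈ dyadicBox n k) (hq' : q' ∈ dyadicBox n k) (hne : q ≠ q') :
    δ k ≤ dist (α q) (α q') := by
  have h1 := hα (q - q') (sub_ne_zero.2 hne)
  rw [map_sub, ← dist_eq_norm (α q)] at h1
  refine le_of_pow_le_pow_left₀ hm.ne' dist_nonneg ?_
  rw [hδk, div_le_iff₀ (by positivity), mul_comm]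
  refine h1.trans ?_
  gcongr
  exact norm_sub_le_of_mem_dyadicBox hq hq'

theorem tendsto_zero_of_pow_eq (hm : 0 < m) (hn : 0 < n) (hδ : ∀ k, 0 < δ k)
    (hδc : ∀ k, δ k ^ m = c / (2 ^ k) ^ n) : Tendsto δ atTop (nhds 0) := by
  have h1 : Tendsto (fun k : ℕ => c * (((1 / 2 : ℝ) ^ n) ^ k)) atTop (nhds (c * 0)) :=
    (tendsto_pow_atTop_nhds_zero_of_lt_one (by positivity)
      (pow_lt_one₀ (by norm_num) (by norm_num) hn.ne')).const_mul c
  rw [mul_zero] at h1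
  have h2 := h1.rpow_const (p := (m : ℝ)⁻¹) (Or.inr (by positivity))
  rw [Real.zero_rpow (by positivity)] at h2
  refine h2.congr fun k => ?_
  rw [show c * (((1 / 2 : ℝ) ^ n) ^ k) = δ k ^ m by
    rw [hδc, ← pow_mul, ← pow_mul, mul_comm n k]; simp [div_eq_mul_inv]]
  exact Real.pow_rpow_inv_natCast (hδ k).le hm.ne'

theorem le_one_of_pow_eq (hm : 0 < m) (hc1 : c ≤ 1) {k : ℕ}
    (hδc : δ k ^ m = c / (2 ^ k) ^ n) : δ k ≤ 1 := by
  by_contra! h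
  have h1 : 1 < δ k ^ m := one_lt_pow₀ h hm.ne'
  rw [hδc, lt_div_iff₀ (by positivity)] at h1
  have : (1 : ℝ) ≤ (2 ^ k) ^ n := one_le_pow₀ (one_le_pow₀ (by norm_num))
  linarith

theorem denseRange_of_badlyApproximable (hm : 0 < m) (hn : 0 < n) (hc : 0 < c) (hc1 : c ≤ 1)
    (hα : ∀ q, q ≠ 0 → c ≤ ‖q‖ ^ n * ‖α q‖ ^ m) (hδ : ∀ k, 0 < δ k)
    (hδc : ∀ k, δ k ^ m = c / (2 ^ k) ^ n) : Dense (Set.range α) := by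
  have key : ENNReal.ofReal ((2 / 3) ^ m * c) ≤ volume (closure (Set.range α)) := by
    have h1 := tendsto_measure_cthickening (μ := (volume : Measure (UnitAddTorus (Fin m))))
      (s := Set.range α) ⟨1, one_pos, measure_ne_top _ _⟩
    have h2 := h1.comp (tendsto_zero_of_pow_eq hm hn hδ hδc)
    refine ge_of_tendsto' h2 fun k => ?_
    have h3 := volume_real_biUnion_closedBall (dyadicBox n k) α (hδ k)
      (le_one_of_pow_eq hm hc1 (hδc k)) fun q hq q' hq' hne =>
        le_dist_of_mem_dyadicBox hα hm (hδc k) hq hq' hne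
    refine ENNReal.ofReal_le_of_le_toReal ?_
    have h4 : (2 / 3) ^ m * c = (dyadicBox n k).card * (2 * (δ k / 3)) ^ m := by
      rw [card_dyadicBox, show 2 * (δ k / 3) = δ k * (2 / 3) by ring, mul_pow, hδc]
      push_cast
      field_simp
    rw [h4, ← h3]
    refine measureReal_mono ?_ (measure_ne_top _ _)
    refine Set.iUnion₂_subset fun q _ => ?_
    refine (Metric.closedBall_subset_closedBall ?_).trans
      (Metric.closedBall_subset_cthickening (Set.mem_range_self q) _)
    linarith [hδ k]
  rw [← AddMonoidHom.coe_range]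
  refine dense_of_measure_closure_pos (μ := volume) α.range ?_
  rw [AddMonoidHom.coe_range]
  exact lt_of_lt_of_le (ENNReal.ofReal_pos.2 (by positivity)) key

/-- Quasi-independence of the balls attached to two dyadic scales `k ≤ l`. -/
theorem sum_sum_volume_inter_le (hm : 0 < m) (hn : 0 < n) (hc : 0 < c) (hc1 : c ≤ 1)
    (hα : ∀ q, q ≠ 0 → c ≤ ‖q‖ ^ n * ‖α q‖ ^ m) (hδ : ∀ k, 0 < δ k)
    (hδc : ∀ k, δ k ^ m = c / (2 ^ k) ^ n) {r : ℕ → ℝ} (hr : ∀ k, 0 < r k)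
    (hrδ : ∀ k, r k ≤ δ k / 3) {k l : ℕ} (hkl : k ≤ l) :
    ∑ q ∈ dyadicBox n k, ∑ q' ∈ dyadicBox n l, volume.real
      (Metric.closedBall (α q) (r k) ∩ Metric.closedBall (α q') (r l)) ≤
    12 ^ m * (((2 ^ k) ^ n * r k ^ m) * ((2 ^ l) ^ n * r l ^ m) / c +
      (1 / 2) ^ (l - k) * ((2 ^ l) ^ n * r l ^ m)) := by
  classical
  have inner : ∀ q ∈ dyadicBox n k, ∑ q' ∈ dyadicBox n l, volume.real
      (Metric.closedBall (α q) (r k) ∩ Metric.closedBall (α q') (r l)) ≤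
      6 ^ m * (r k ^ m * (2 ^ l) ^ n / c + 1) * (2 * r l) ^ m := by
    intro q _
    set J := (dyadicBox n l).filter fun q' => dist (α q') (α q) ≤ r k + r l with hJ
    have hcard := card_mul_pow_le_of_separated J α (hδ l) (le_one_of_pow_eq hm hc1 (hδc l))
      (fun q₁ h₁ q₂ h₂ hne => le_dist_of_mem_dyadicBox hα hm (hδc l)
        (Finset.mem_filter.1 h₁).1 (Finset.mem_filter.1 h₂).1 hne)
      (by have := hr k; have := hr l; positivity : 0 ≤ r k + r l) (α q)
      fun q' hq' => (Finset.mem_filter.1 hq').2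
    have hcard2 : (J.card : ℝ) ≤ 6 ^ m * (r k ^ m * (2 ^ l) ^ n / c + 1) := by
      have h1 : (r k + r l + δ l / 3) ^ m ≤ 2 ^ m * (r k ^ m + δ l ^ m) := by
        calc (r k + r l + δ l / 3) ^ m ≤ (r k + δ l) ^ m := by
              have := hr k; have := hr l; have := hδ l; have := hrδ l
              gcongr ?_ ^ m
              linarith
          _ ≤ 2 ^ (m - 1) * (r k ^ m + δ l ^ m) := add_pow_le (hr k).le (hδ l).le m
          _ ≤ 2 ^ m * (r k ^ m + δ l ^ m) := by
              have := hr k; have := hδ l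
              gcongr
              · norm_num
              · omega
      have h2 : J.card * δ l ^ m ≤ 6 ^ m * (r k ^ m + δ l ^ m) := by
        calc _ ≤ _ := hcard
          _ ≤ 3 ^ m * (2 ^ m * (r k ^ m + δ l ^ m)) := by gcongr
          _ = _ := by rw [← mul_assoc, ← mul_pow]; norm_num
      rw [← le_div_iff₀ (pow_pos (hδ l) m)] at h2
      refine h2.trans (le_of_eq ?_)
      rw [hδc l]
      field_simp
    calc ∑ q' ∈ dyadicBox n l, volume.real
          (Metric.closedBall (α q) (r k) ∩ Metric.closedBall (α q') (r l))
        = ∑ q' ∈ J, volume.real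
          (Metric.closedBall (α q) (r k) ∩ Metric.closedBall (α q') (r l)) := by
          refine (Finset.sum_subset (Finset.filter_subset _ _) fun q' hq' hnot => ?_).symm
          have hlt : r k + r l < dist (α q') (α q) := by
            by_contra! h
            exact hnot (Finset.mem_filter.2 ⟨hq', h⟩)
          rw [dist_comm] at hlt
          rw [(Metric.closedBall_disjoint_closedBall hlt).inter_eq]
          simp
      _ ≤ J.card • (2 * r l) ^ m := Finset.sum_le_card_nsmul _ _ _ fun q' _ =>
          (measureReal_mono Set.inter_subset_right (measure_ne_top _ _)).trans
            (volume_real_closedBall_torus_le _ (hr l).le)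
      _ ≤ _ := by
          rw [nsmul_eq_mul]
          have := hr l
          gcongr
  refine (Finset.sum_le_card_nsmul _ _ _ inner).trans ?_
  rw [nsmul_eq_mul, card_dyadicBox]
  have hpow : ((2 : ℝ) ^ k) ^ n ≤ (1 / 2) ^ (l - k) * (2 ^ l) ^ n := by
    obtain ⟨d, rfl⟩ := Nat.exists_eq_add_of_le hkl
    rw [Nat.add_sub_cancel_left, pow_add, mul_pow, mul_left_comm]
    refine le_mul_of_one_le_right (by positivity) ?_
    rw [one_div, inv_pow, inv_mul_eq_div, one_le_div (by positivity)]
    exact le_self_pow₀ (one_le_pow₀ (by norm_num)) hn.ne'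
  have h12 : (12 : ℝ) ^ m = 6 ^ m * 2 ^ m := by rw [← mul_pow]; norm_num
  push_cast
  rw [h12, mul_pow]
  have e : ((2 : ℝ) ^ k) ^ n * (6 ^ m * (r k ^ m * (2 ^ l) ^ n / c + 1) * (2 ^ m * r l ^ m)) =
      6 ^ m * 2 ^ m * ((2 ^ k) ^ n * r k ^ m * ((2 ^ l) ^ n * r l ^ m) / c +
        (2 ^ k) ^ n * r l ^ m) := by ring
  rw [e, ← mul_assoc ((1 / 2 : ℝ) ^ (l - k))]
  have := hr l
  gcongr

end Orbit

section ApproxSet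

variable {m n : ℕ} {α : (Fin n → ℤ) →+ UnitAddTorus (Fin m)} {c : ℝ}

/-- Points of the torus approximated infinitely often by the orbit `α` at rate `φ`. -/
def approxSet (α : (Fin n → ℤ) →+ UnitAddTorus (Fin m)) (φ : ℝ → ℝ) : Set (UnitAddTorus (Fin m)) :=
  {b | {q : Fin n → ℤ | dist (α q) b < φ ‖q‖}.Infinite}

theorem measurableSet_approxSet (φ : ℝ → ℝ) : MeasurableSet (approxSet α φ) := by
  have : approxSet α φ =
      ⋂ t : Finset (Fin n → ℤ), ⋃ q ∈ {q | q ∉ t}, {b | dist (α q) b < φ ‖q‖} := by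
    ext b
    simp only [approxSet, Set.mem_ofPred_eq, Set.mem_iInter, Set.mem_iUnion, exists_prop]
    constructor
    · intro h t
      obtain ⟨q, hq, hqt⟩ := h.exists_notMem_finset t
      exact ⟨q, hqt, hq⟩
    · intro h hfin
      obtain ⟨q, hqt, hq⟩ := h hfin.toFinset
      exact hqt (hfin.mem_toFinset.2 hq)
  rw [this]
  refine MeasurableSet.iInter fun t => MeasurableSet.biUnion (Set.to_countable _) fun q _ => ?_
  exact (isOpen_lt (by fun_prop) continuous_const).measurableSet

theorem volume_range_eq_zero (hm : 0 < m) : volume (Set.range α) = 0 := by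
  rw [← Set.biUnion_of_singleton (Set.range α), measure_biUnion_null_iff (Set.countable_range α)]
  intro x _
  have h := volume_closedBall_torus_le x le_rfl
  rw [Metric.closedBall_zero] at h
  simpa [hm.ne'] using h

theorem mem_approxSet_of_frequently {φ : ℝ → ℝ} {r : ℕ → ℝ} (hr0 : Tendsto r atTop (nhds 0))
    (hrφ : ∀ k t, 0 < t → t ≤ 2 ^ k → r k < φ t) {b : UnitAddTorus (Fin m)} (hb : b ∉ Set.range α)
    (h : ∀ M, ∃ k ≥ M, ∃ q ∈ dyadicBox n k, dist b (α q) ≤ r k) : b ∈ approxSet α φ := by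
  intro hfin
  have hpos : ∀ q, 0 < dist b (α q) := fun q => dist_pos.2 fun h => hb ⟨q, h.symm⟩
  obtain ⟨q₀, _, hq₀⟩ := (hfin.insert 0).exists_minimalFor (fun q => dist b (α q)) _
    ⟨0, Set.mem_insert _ _⟩
  obtain ⟨M, hM⟩ := eventually_atTop.1 (hr0.eventually_lt_const (hpos q₀))
  obtain ⟨k, hk, q, hq, hqr⟩ := h M
  have hlt := hM k hk
  have hmem : q ∈ insert 0 {q : Fin n → ℤ | dist (α q) b < φ ‖q‖} := by
    by_cases h0 : q = 0
    · exact Or.inl h0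
    · refine Or.inr ?_
      rw [Set.mem_ofPred_eq, dist_comm]
      exact hqr.trans_lt (hrφ k _ (norm_pos_iff.2 h0) (norm_le_of_mem_dyadicBox hq))
  have := hq₀ hmem (by simp only; linarith)
  simp only at this
  linarith

theorem exists_le_volume_iUnion (hm : 0 < m) (hn : 0 < n) (hc : 0 < c) (hc1 : c ≤ 1)
    (hα : ∀ q, q ≠ 0 → c ≤ ‖q‖ ^ n * ‖α q‖ ^ m) {δ : ℕ → ℝ} (hδ : ∀ k, 0 < δ k)
    (hδc : ∀ k, δ k ^ m = c / (2 ^ k) ^ n) {r : ℕ → ℝ} (hr : ∀ k, 0 < r k)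
    (hrδ : ∀ k, r k ≤ δ k / 3) (hs : ¬ Summable fun k => ((2 : ℝ) ^ k) ^ n * r k ^ m) :
    ∃ κ > 0, ∀ M, κ ≤ volume.real
      (⋃ k ∈ Set.Ici M, ⋃ q ∈ dyadicBox n k, Metric.closedBall (α q) (r k)) := by
  set s : ℕ → ℝ := fun k => ((2 : ℝ) ^ k) ^ n * r k ^ m with hsdef
  have hs0 : ∀ k, 0 ≤ s k := fun k => by have := hr k; positivity
  set C : ℝ := 12 ^ m * (1 / c + 4) with hC
  have hCpos : 0 < C := by positivity
  refine ⟨C⁻¹, inv_pos.2 hCpos, fun M => ?_⟩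
  obtain ⟨N, hN⟩ := exists_one_le_sum_Ico hs0 hs M
  set I := Finset.Ico M N
  set S := ∑ k ∈ I, s k with hS
  have hsum : ∑ i ∈ I.sigma (dyadicBox n), volume.real (Metric.closedBall (α i.2) (r i.1)) =
      2 ^ m * S := by
    rw [Finset.sum_sigma, hS, Finset.mul_sum]
    refine Finset.sum_congr rfl fun k _ => ?_
    have h1 := le_one_of_pow_eq hm hc1 (hδc k)
    have h2 := hrδ k
    simp_rw [volume_real_closedBall_torus _ (hr k).le (by linarith)]
    rw [Finset.sum_const, card_dyadicBox, nsmul_eq_mul, hsdef, mul_pow]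
    push_cast
    ring
  set v : ℕ → ℕ → ℝ := fun k l => if k ≤ l then (1 / 2 : ℝ) ^ (l - k) * s l else 0 with hv
  have hv0 : ∀ k l, 0 ≤ v k l := fun k l => by
    have := hs0 l
    simp only [hv]
    split_ifs <;> positivity
  have hle : ∀ k l, k ≤ l → ∑ q ∈ dyadicBox n k, ∑ q' ∈ dyadicBox n l, volume.real
      (Metric.closedBall (α q) (r k) ∩ Metric.closedBall (α q') (r l)) ≤
      12 ^ m * (s k * s l / c + v k l + v l k) := by
    intro k l hkl
    refine (sum_sum_volume_inter_le hm hn hc hc1 hα hδ hδc hr hrδ hkl).trans ?_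
    have h1 : v k l = (1 / 2 : ℝ) ^ (l - k) * s l := if_pos hkl
    have h2 := hv0 l k
    rw [← h1]
    exact mul_le_mul_of_nonneg_left (le_add_of_nonneg_right h2) (by positivity)
  have hpair : ∀ k l, ∑ q ∈ dyadicBox n k, ∑ q' ∈ dyadicBox n l, volume.real
      (Metric.closedBall (α q) (r k) ∩ Metric.closedBall (α q') (r l)) ≤
      12 ^ m * (s k * s l / c + v k l + v l k) := by
    intro k l
    rcases le_total k l with hkl | hkl
    · exact hle k l hkl
    · rw [Finset.sum_comm]
      simp_rw [Set.inter_comm (Metric.closedBall (α _) (r k))]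
      refine (hle l k hkl).trans (le_of_eq ?_)
      ring
  have hdouble : ∑ i ∈ I.sigma (dyadicBox n), ∑ j ∈ I.sigma (dyadicBox n), volume.real
      (Metric.closedBall (α i.2) (r i.1) ∩ Metric.closedBall (α j.2) (r j.1)) ≤ C * S ^ 2 := by
    simp_rw [Finset.sum_sigma]
    calc _ = ∑ k ∈ I, ∑ l ∈ I, ∑ q ∈ dyadicBox n k, ∑ q' ∈ dyadicBox n l, volume.real
          (Metric.closedBall (α q) (r k) ∩ Metric.closedBall (α q') (r l)) :=
          Finset.sum_congr rfl fun k _ => Finset.sum_comm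
      _ ≤ ∑ k ∈ I, ∑ l ∈ I, 12 ^ m * (s k * s l / c + v k l + v l k) :=
          Finset.sum_le_sum fun k _ => Finset.sum_le_sum fun l _ => hpair k l
      _ = 12 ^ m * (S * S / c + ∑ k ∈ I, ∑ l ∈ I, v k l + ∑ k ∈ I, ∑ l ∈ I, v k l) := by
          simp_rw [← Finset.mul_sum, Finset.sum_add_distrib, ← Finset.sum_div]
          rw [Finset.sum_mul_sum, Finset.sum_comm (f := fun k l => v l k)]
      _ ≤ 12 ^ m * (S * S / c + 2 * S + 2 * S) := by
          have := sum_sum_geometric_le I hs0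
          gcongr
      _ ≤ C * S ^ 2 := by
          have : S ≤ S ^ 2 := by nlinarith
          calc _ = 12 ^ m * (1 / c * S ^ 2 + 4 * S) := by ring
            _ ≤ 12 ^ m * (1 / c * S ^ 2 + 4 * S ^ 2) := by gcongr
            _ = _ := by rw [hC]; ring
  have hCE := inv_le_measure_biUnion (μ := volume) (I.sigma (dyadicBox n))
    (fun i => Metric.closedBall (α i.2) (r i.1))
    (fun i => Metric.isClosed_closedBall.measurableSet) hCpos
    (by rw [hsum]; positivity) (hdouble.trans (by
      rw [hsum]
      have : S ≤ 2 ^ m * S := le_mul_of_one_le_left (by linarith) (one_le_pow₀ (by norm_num))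
      gcongr))
  refine hCE.trans (measureReal_mono ?_ (measure_ne_top _ _))
  intro x hx
  simp only [Set.mem_iUnion, Finset.mem_sigma, exists_prop, Sigma.exists] at hx
  obtain ⟨k, q, ⟨hk, hq⟩, hx⟩ := hx
  simp only [Set.mem_iUnion, exists_prop]
  exact ⟨k, (Finset.mem_Ico.1 hk).1, q, hq, hx⟩

theorem volume_approxSet_pos (hm : 0 < m) (hn : 0 < n) (hc : 0 < c) (hc1 : c ≤ 1)
    (hα : ∀ q, q ≠ 0 → c ≤ ‖q‖ ^ n * ‖α q‖ ^ m) {δ : ℕ → ℝ} (hδ : ∀ k, 0 < δ k)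
    (hδc : ∀ k, δ k ^ m = c / (2 ^ k) ^ n) {φ : ℝ → ℝ} (hφ : ∀ t, 0 < t → 0 < φ t)
    (hφdec : ∀ x y, 0 < x → x ≤ y → φ y ≤ φ x)
    (hs : ¬ Summable fun k : ℕ => ((2 : ℝ) ^ k) ^ n * φ (2 ^ k) ^ m) :
    0 < volume (approxSet α φ) := by
  set r : ℕ → ℝ := fun k => min (φ (2 ^ k) / 2) (δ k / 3) with hrdef
  have hφk : ∀ k : ℕ, 0 < φ (2 ^ k) := fun k => hφ _ (by positivity)
  have hr : ∀ k, 0 < r k := fun k => lt_min (half_pos (hφk k)) (by linarith [hδ k])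
  have hrδ : ∀ k, r k ≤ δ k / 3 := fun k => min_le_right _ _
  have hr0 : Tendsto r atTop (nhds 0) :=
    squeeze_zero (fun k => (hr k).le) (fun k => (hrδ k).trans (by linarith [hδ k]))
      (tendsto_zero_of_pow_eq hm hn hδ hδc)
  have hrφ : ∀ k t, 0 < t → t ≤ 2 ^ k → r k < φ t := fun k t ht htk =>
    calc r k ≤ φ (2 ^ k) / 2 := min_le_left _ _
      _ < φ (2 ^ k) := half_lt_self (hφk k)
      _ ≤ φ t := hφdec _ _ ht htk
  have hsr : ¬ Summable fun k => ((2 : ℝ) ^ k) ^ n * r k ^ m := by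
    have h1 : ¬ Summable fun k : ℕ => (((2 : ℝ) ^ k) ^ n * φ (2 ^ k) ^ m) * (1 / 2) ^ m := by
      rwa [summable_mul_right_iff (by positivity)]
    have h2 := not_summable_min (e := c * (1 / 3) ^ m) (by positivity) h1
    refine fun h => h2 (h.congr fun k => ?_)
    have h3 : r k ^ m = min ((φ (2 ^ k) / 2) ^ m) ((δ k / 3) ^ m) := by
      have hA : (0 : ℝ) ≤ φ (2 ^ k) / 2 := (half_pos (hφk k)).le
      have hB : (0 : ℝ) ≤ δ k / 3 := by linarith [hδ k]
      simp only [hrdef]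
      rcases le_total (φ (2 ^ k) / 2) (δ k / 3) with h | h
      · rw [min_eq_left h, min_eq_left (pow_le_pow_left₀ hA h m)]
      · rw [min_eq_right h, min_eq_right (pow_le_pow_left₀ hB h m)]
    rw [h3, mul_min_of_nonneg _ _ (by positivity), div_pow, div_pow, hδc]
    congr 1
    · rw [one_div, inv_pow]; ring
    · rw [one_div, inv_pow]; field_simp
  obtain ⟨κ, hκ, hle⟩ := exists_le_volume_iUnion hm hn hc hc1 hα hδ hδc hr hrδ hsr
  have hpos := measure_iInter_pos_of_antitone (μ := (volume : Measure (UnitAddTorus (Fin m))))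
    (E := fun M => ⋃ k ∈ Set.Ici M, ⋃ q ∈ dyadicBox n k, Metric.closedBall (α q) (r k))
    (fun M => MeasurableSet.biUnion (Set.to_countable _) fun k _ =>
      Finset.measurableSet_biUnion _ fun q _ => Metric.isClosed_closedBall.measurableSet)
    (fun M M' h => Set.biUnion_subset_biUnion_left (Set.Ici_subset_Ici.2 h)) hκ hle
  rw [← measure_sdiff_null (volume_range_eq_zero (α := α) hm)] at hpos
  refine hpos.trans_le (measure_mono ?_)
  rintro b ⟨hb, hbr⟩
  refine mem_approxSet_of_frequently hr0 hrφ hbr fun M => ?_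
  have := Set.mem_iInter.1 hb M
  simp only [Set.mem_iUnion, exists_prop] at this
  obtain ⟨k, hk, q, hq, hx⟩ := this
  exact ⟨k, hk, q, hq, hx⟩

theorem finite_setOf_norm_le (R : ℝ) : {q : Fin n → ℤ | ‖q‖ ≤ R}.Finite := by
  have := (isCompact_closedBall (0 : Fin n → ℤ) R).finite_of_discrete
  simpa [Metric.closedBall, dist_zero_right] using this

theorem mem_approxSet_of_add_mem {ψ : ℝ → ℝ} (hψdec : ∀ x y, 0 < x → x ≤ y → ψ y ≤ ψ x)
    {p : Fin n → ℤ} {b : UnitAddTorus (Fin m)} (h : α p + b ∈ approxSet α fun t => ψ (2 * t)) :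
    b ∈ approxSet α ψ := by
  have h1 : ({q : Fin n → ℤ | dist (α q) (α p + b) < ψ (2 * ‖q‖)} \ {q | ‖q‖ ≤ ‖p‖}).Infinite :=
    h.sdiff (finite_setOf_norm_le _)
  refine (h1.image (sub_left_injective (b := p)).injOn).mono ?_
  rintro _ ⟨q, ⟨hq, hqp⟩, rfl⟩
  rw [Set.mem_ofPred_eq, not_le] at hqp
  rw [Set.mem_ofPred_eq] at hq ⊢
  have e : dist (α (q - p)) b = dist (α q) (α p + b) := by
    rw [dist_eq_norm, dist_eq_norm, map_sub]
    congr 1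
    abel
  rw [e]
  refine hq.trans_le (hψdec _ _ ?_ ?_)
  · rw [norm_pos_iff, sub_ne_zero]
    rintro rfl
    exact lt_irrefl _ hqp
  · linarith [norm_sub_le q p]

theorem volume_approxSet_eq_one (hm : 0 < m) (hn : 0 < n) (hc : 0 < c) (hc1 : c ≤ 1)
    (hα : ∀ q, q ≠ 0 → c ≤ ‖q‖ ^ n * ‖α q‖ ^ m) {ψ : ℝ → ℝ} (hψ : ∀ t, 0 < t → 0 < ψ t)
    (hψdec : ∀ x y, 0 < x → x ≤ y → ψ y ≤ ψ x)
    (hs : ¬ Summable fun q : ℕ => ((q : ℝ) + 1) ^ (n - 1) * ψ ((q : ℝ) + 1) ^ m) :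
    volume (approxSet α ψ) = 1 := by
  choose δ hδ hδc using fun k : ℕ => exists_pos_pow_eq hm (x := c / (2 ^ k) ^ n) (by positivity)
  have hs' : ¬ Summable fun k : ℕ => ((2 : ℝ) ^ k) ^ n * ψ (2 * 2 ^ k) ^ m := by
    intro h
    have h1 : Summable fun k : ℕ => (2 : ℝ) ^ (k * n) * ψ (2 ^ k) ^ m := by
      rw [← summable_nat_add_iff 1]
      refine (h.mul_left (2 ^ n)).congr fun k => ?_
      rw [pow_succ' (2 : ℝ) k]
      ring
    have h2 := summable_pow_mul_of_summable_condensed (d := n - 1)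
      (f := fun j => ψ j ^ m)
      (fun j hj => (pow_pos (hψ _ (by exact_mod_cast hj)) _).le)
      (fun i j hi hij => pow_le_pow_left₀ (hψ _ (by exact_mod_cast hi.trans_le hij)).le
        (hψdec _ _ (by exact_mod_cast hi) (by exact_mod_cast hij)) _)
      (by rw [Nat.sub_add_cancel hn]; exact_mod_cast h1)
    refine hs ?_
    exact_mod_cast h2
  have hpos := volume_approxSet_pos hm hn hc hc1 hα hδ hδc (φ := fun t => ψ (2 * t))
    (fun t ht => hψ _ (by positivity)) (fun x y hx hxy => hψdec _ _ (by positivity) (by linarith))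
    hs'
  set L := approxSet α fun t => ψ (2 * t) with hL
  set U : Set (UnitAddTorus (Fin m)) := ⋃ p, (α p + ·) ⁻¹' L with hU
  have hUm : MeasurableSet U := MeasurableSet.iUnion fun p =>
    (measurableSet_approxSet _).preimage (measurable_const_add _)
  have hLU : L ⊆ U := fun b hb => Set.mem_iUnion.2 ⟨0, by simpa using hb⟩
  have hUW : U ⊆ approxSet α ψ := Set.iUnion_subset fun p b hb =>
    mem_approxSet_of_add_mem hψdec hb
  have hinv : ∀ g ∈ Set.range α, (g + ·) ⁻¹' U = U := by
    rintro _ ⟨p₀, rfl⟩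
    ext b
    simp only [hU, Set.mem_preimage, Set.mem_iUnion]
    constructor
    · rintro ⟨p, hp⟩
      exact ⟨p + p₀, by rwa [map_add, add_assoc]⟩
    · rintro ⟨p, hp⟩
      exact ⟨p - p₀, by rwa [map_sub, ← add_assoc, sub_add_cancel]⟩
  have hae := ae_mem_of_dense_invariant (μ := volume)
    (denseRange_of_badlyApproximable hm hn hc hc1 hα hδ hδc) hUm hinv
    (hpos.trans_le (measure_mono hLU)).ne'
  rw [← volume_univ_torus]
  refine measure_congr (eventuallyEq_univ.2 ?_)
  filter_upwards [hae] with b hb using hUW hb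

end ApproxSet

section Convergence

/-- The integer vectors with all coordinates bounded by `j` in absolute value. -/
noncomputable def centeredBox (n j : ℕ) : Finset (Fin n → ℤ) :=
  Fintype.piFinset fun _ => Finset.Icc (-(j : ℤ)) j

theorem card_centeredBox (n j : ℕ) : (centeredBox n j).card = (2 * j + 1) ^ n := by
  rw [centeredBox, Fintype.card_piFinset_const, Int.card_Icc]
  congr 1
  omega

theorem mem_centeredBox {n j : ℕ} {q : Fin n → ℤ} : q ∈ centeredBox n j ↔ ‖q‖ ≤ j := by
  rw [centeredBox, Fintype.mem_piFinset, pi_norm_le_iff_of_nonneg (by positivity)]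
  refine forall_congr' fun i => ?_
  rw [Finset.mem_Icc, ← abs_le, Int.norm_eq_abs]
  exact_mod_cast Iff.rfl

theorem le_norm_of_notMem_centeredBox {n j : ℕ} {q : Fin n → ℤ} (hq : q ∉ centeredBox n j) :
    (j : ℝ) + 1 ≤ ‖q‖ := by
  by_contra! h
  rw [pi_norm_lt_iff (by positivity)] at h
  refine hq (mem_centeredBox.2 ((pi_norm_le_iff_of_nonneg (by positivity)).2 fun i => ?_))
  have := h i
  rw [Int.norm_eq_abs] at this ⊢
  have h2 : |q i| < (j : ℤ) + 1 := by exact_mod_cast this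
  have h3 : |q i| ≤ (j : ℤ) := by omega
  exact_mod_cast h3

theorem card_centeredBox_sdiff_le (n j : ℕ) :
    ((centeredBox n (j + 1) \ centeredBox n j).card : ℝ) ≤
      2 * n * 3 ^ (n - 1) * ((j : ℝ) + 1) ^ (n - 1) := by
  have hsub : centeredBox n j ⊆ centeredBox n (j + 1) := fun q hq => by
    rw [mem_centeredBox] at hq ⊢
    push_cast
    linarith
  rw [Finset.cast_card_sdiff hsub, card_centeredBox, card_centeredBox]
  push_cast
  refine (le_abs_self _).trans ((abs_pow_sub_pow_le _ _ _).trans ?_)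
  have h0 : (0 : ℝ) ≤ j := j.cast_nonneg
  rw [abs_of_nonneg (by linarith : (0 : ℝ) ≤ 2 * ((j : ℝ) + 1) + 1 - (2 * j + 1)),
    abs_of_nonneg (by positivity), abs_of_nonneg (by positivity), max_eq_left (by linarith),
    show 2 * ((j : ℝ) + 1) + 1 - (2 * j + 1) = 2 by ring, mul_assoc _ ((3 : ℝ) ^ (n - 1)),
    ← mul_pow]
  gcongr
  linarith

theorem tsum_ne_top_of_le_antitone {n : ℕ} {f : (Fin n → ℤ) → ENNReal} (hf0 : f 0 ≠ ⊤)
    {g : ℝ → ℝ} (hg0 : ∀ t, 0 < t → 0 ≤ g t) (hg : ∀ x y, 0 < x → x ≤ y → g y ≤ g x)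
    (hfg : ∀ q, q ≠ 0 → f q ≤ ENNReal.ofReal (g ‖q‖))
    (hs : Summable fun j : ℕ => ((j : ℝ) + 1) ^ (n - 1) * g ((j : ℝ) + 1)) :
    ∑' q, f q ≠ ⊤ := by
  have hcover : (⋃ j, ((centeredBox n (j + 1) \ centeredBox n j : Finset (Fin n → ℤ)) :
      Set (Fin n → ℤ))) = {0}ᶜ := by
    ext q
    simp only [Set.mem_iUnion, Finset.mem_coe, Finset.mem_sdiff, Set.mem_compl_singleton_iff]
    constructor
    · rintro ⟨j, -, hj⟩ rfl
      exact hj (mem_centeredBox.2 (by simp))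
    · intro hq
      have hex : ∃ j, q ∈ centeredBox n j := by
        obtain ⟨j, hj⟩ := exists_nat_ge ‖q‖
        exact ⟨j, mem_centeredBox.2 hj⟩
      classical
      have hne : Nat.find hex ≠ 0 := by
        intro h
        have := mem_centeredBox.1 (Nat.find_spec hex)
        rw [h] at this
        exact hq (by simpa using this)
      obtain ⟨j, hj⟩ := Nat.exists_eq_succ_of_ne_zero hne
      refine ⟨j, ?_, Nat.find_min hex (by omega)⟩
      have := Nat.find_spec hex
      rwa [hj] at this
  have hsplit : ∑' q, f q = f 0 + ∑' q : ({0}ᶜ : Set (Fin n → ℤ)), f q := by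
    rw [← ENNReal.summable.tsum_add_tsum_compl (s := {0}) ENNReal.summable, tsum_singleton]
  rw [hsplit, ← hcover]
  refine ENNReal.add_ne_top.2 ⟨hf0, ne_top_of_le_ne_top ?_ (ENNReal.tsum_iUnion_le_tsum _ _)⟩
  refine ne_top_of_le_ne_top (hs.mul_left (2 * n * 3 ^ (n - 1) : ℝ)).tsum_ofReal_ne_top
    (ENNReal.tsum_le_tsum fun j => ?_)
  rw [Finset.tsum_subtype' (centeredBox n (j + 1) \ centeredBox n j) f]
  have hterm : ∀ q ∈ centeredBox n (j + 1) \ centeredBox n j,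
      f q ≤ ENNReal.ofReal (g ((j : ℝ) + 1)) := by
    intro q hq
    have h1 := le_norm_of_notMem_centeredBox (Finset.mem_sdiff.1 hq).2
    have h2 : (0 : ℝ) < j + 1 := by positivity
    exact (hfg q (norm_pos_iff.1 (h2.trans_le h1))).trans
      (ENNReal.ofReal_le_ofReal (hg _ _ h2 h1))
  refine (Finset.sum_le_card_nsmul _ _ _ hterm).trans ?_
  have hgj := hg0 ((j : ℝ) + 1) (by positivity)
  rw [nsmul_eq_mul, ← ENNReal.ofReal_natCast, ← ENNReal.ofReal_mul (by positivity), ← mul_assoc]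
  exact ENNReal.ofReal_le_ofReal
    (mul_le_mul_of_nonneg_right (card_centeredBox_sdiff_le n j) hgj)

theorem volume_approxSet_eq_zero {m n : ℕ} {α : (Fin n → ℤ) →+ UnitAddTorus (Fin m)} {ψ : ℝ → ℝ}
    (hψ : ∀ t, 0 < t → 0 < ψ t) (hψdec : ∀ x y, 0 < x → x ≤ y → ψ y ≤ ψ x)
    (hs : Summable fun q : ℕ => ((q : ℝ) + 1) ^ (n - 1) * ψ ((q : ℝ) + 1) ^ m) :
    volume (approxSet α ψ) = 0 := by
  have h : ∑' q : Fin n → ℤ, volume {b | dist (α q) b < ψ ‖q‖} ≠ ⊤ := by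
    refine tsum_ne_top_of_le_antitone (measure_ne_top _ _) (g := fun t => (2 * ψ t) ^ m)
      (fun t ht => by have := hψ t ht; positivity) (fun x y hx hxy => ?_) (fun q hq => ?_) ?_
    · have := hψ y (hx.trans_le hxy)
      have := hψdec x y hx hxy
      gcongr
    · refine (measure_mono ?_).trans
        (volume_closedBall_torus_le (α q) (hψ _ (norm_pos_iff.2 hq)).le)
      intro b hb
      rw [Metric.mem_closedBall, dist_comm]
      exact le_of_lt hb
    · refine (hs.mul_left (2 ^ m)).congr fun j => ?_
      ring
  have := measure_limsup_cofinite_eq_zero h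
  refine measure_mono_null (fun b hb => ?_) this
  rw [mem_limsup_iff_frequently_mem]
  exact frequently_cofinite_iff_infinite.2 hb

end Convergence

section Transfer

/-- The projection of `ℝ^m` onto the torus. -/
noncomputable def toTorus {m : ℕ} (x : Fin m → ℝ) : UnitAddTorus (Fin m) := fun i => x i

theorem norm_toTorus {m : ℕ} (x : Fin m → ℝ) : ‖toTorus x‖ = intDist x := by
  have h0 : ∀ p : Fin m → ℤ, 0 ≤ ‖x - fun i => (p i : ℝ)‖ := fun p => norm_nonneg _
  refine le_antisymm (le_ciInf fun p => ?_) ((ciInf_le ⟨0, ?_⟩ fun i => round (x i)).trans ?_)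
  · refine (pi_norm_le_iff_of_nonneg (h0 p)).2 fun i => ?_
    rw [toTorus, UnitAddCircle.norm_eq]
    exact (round_le (x i) (p i)).trans (norm_le_pi_norm (x - fun i => (p i : ℝ)) i)
  · rintro _ ⟨p, rfl⟩
    exact h0 p
  · refine (pi_norm_le_iff_of_nonneg (norm_nonneg _)).2 fun i => ?_
    have := norm_le_pi_norm (toTorus x) i
    rwa [toTorus, UnitAddCircle.norm_eq] at this

theorem norm_intCast {n : ℕ} (q : Fin n → ℤ) : ‖(fun j => (q j : ℝ))‖ = ‖q‖ := by
  simp only [Pi.norm_def]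
  congr 2

/-- The orbit homomorphism `q ↦ A q` into the torus. -/
noncomputable def orbitHom {m n : ℕ} (A : Matrix (Fin m) (Fin n) ℝ) :
    (Fin n → ℤ) →+ UnitAddTorus (Fin m) where
  toFun q := toTorus (A.mulVec fun j => (q j : ℝ))
  map_zero' := by
    ext i
    simp [toTorus, Matrix.mulVec, dotProduct]
  map_add' q q' := by
    ext i
    simp [toTorus, Matrix.mulVec, dotProduct, mul_add, Finset.sum_add_distrib]

theorem norm_orbitHom {m n : ℕ} (A : Matrix (Fin m) (Fin n) ℝ) (q : Fin n → ℤ) :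
    ‖orbitHom A q‖ = intDist (A.mulVec fun j => (q j : ℝ)) := norm_toTorus _

theorem dist_orbitHom {m n : ℕ} (A : Matrix (Fin m) (Fin n) ℝ) (q : Fin n → ℤ) (b : Fin m → ℝ) :
    dist (orbitHom A q) (toTorus b) = intDist (A.mulVec (fun j => (q j : ℝ)) - b) := by
  rw [dist_eq_norm, ← norm_toTorus]
  congr 1

theorem measurePreserving_toTorus (m : ℕ) : MeasurePreserving (toTorus (m := m))
    (volume.restrict (Set.Icc 0 1)) volume := by
  have h := measurePreserving_pi (fun _ : Fin m => volume.restrict (Set.Ioc (0 : ℝ) (0 + 1)))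
    (fun _ => (volume : Measure UnitAddCircle)) fun _ => UnitAddCircle.measurePreserving_mk 0
  rw [← Measure.restrict_pi_pi, zero_add] at h
  have e := Measure.restrict_congr_set
    (Measure.univ_pi_Ioc_ae_eq_Icc (μ := fun _ => (volume : Measure ℝ))
      (f := fun _ : Fin m => (0 : ℝ)) (g := fun _ => 1))
  rw [e] at h
  exact h

theorem volume_WA (m n : ℕ) (A : Matrix (Fin m) (Fin n) ℝ) (ψ : ℝ → ℝ) :
    volume (WA m n A ψ) = volume (approxSet (orbitHom A) ψ) := by
  rw [← (measurePreserving_toTorus m).measure_preimage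
    (measurableSet_approxSet ψ).nullMeasurableSet, Measure.restrict_apply
      ((measurePreserving_toTorus m).measurable (measurableSet_approxSet ψ)), Set.inter_comm]
  congr 1
  ext b
  simp only [WA, approxSet, Set.mem_inter_iff, Set.mem_preimage, Set.mem_ofPred_eq, dist_orbitHom,
    norm_intCast]

end Transfer

section BadlyApproximable

theorem orbitHom_ne_zero_of_eventually {m n : ℕ} {α : (Fin n → ℤ) →+ UnitAddTorus (Fin m)}
    (h : ∀ᶠ q in cofinite, α q ≠ 0) {q : Fin n → ℤ} (hq : q ≠ 0) : α q ≠ 0 := by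
  intro h0
  have hinj : Function.Injective fun k : ℤ => k • q := smul_left_injective ℤ hq
  refine Set.infinite_range_of_injective hinj ((eventually_cofinite.1 h).subset ?_)
  rintro _ ⟨k, rfl⟩
  exact not_not.2 (by rw [map_zsmul, h0, smul_zero])

theorem BadlyApproximable.exists_le {m n : ℕ} (hm : 0 < m) {A : Matrix (Fin m) (Fin n) ℝ}
    (hA : BadlyApproximable m n A) :
    ∃ c : ℝ, 0 < c ∧ c ≤ 1 ∧ ∀ q, q ≠ 0 → c ≤ ‖q‖ ^ n * ‖orbitHom A q‖ ^ m := by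
  rw [BadlyApproximable, liminf_eq] at hA
  obtain ⟨a, ha0, ha⟩ : ∃ a > 0, ∀ᶠ q : Fin n → ℤ in cofinite,
      a ≤ ‖(fun j => (q j : ℝ))‖ ^ ((n : ℝ) / m) * intDist (A.mulVec fun j => (q j : ℝ)) := by
    by_contra hcon
    refine hA.not_ge (Real.sSup_nonpos fun a ha => ?_)
    by_contra! ha0
    exact hcon ⟨a, ha0, ha⟩
  have hev : ∀ᶠ q : Fin n → ℤ in cofinite, a ^ m ≤ ‖q‖ ^ n * ‖orbitHom A q‖ ^ m := by
    filter_upwards [ha] with q hq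
    rw [norm_intCast, ← norm_orbitHom] at hq
    refine (pow_le_pow_left₀ ha0.le hq m).trans (le_of_eq ?_)
    rw [mul_pow, ← Real.rpow_mul_natCast (norm_nonneg _), div_mul_cancel₀ _ (by positivity),
      Real.rpow_natCast]
  have hne : ∀ q : Fin n → ℤ, q ≠ 0 → 0 < ‖q‖ ^ n * ‖orbitHom A q‖ ^ m := by
    intro q hq
    have h1 : orbitHom A q ≠ 0 := by
      refine orbitHom_ne_zero_of_eventually (hev.mono fun q' hq' h0 => ?_) hq
      rw [h0, norm_zero, zero_pow hm.ne', mul_zero] at hq'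
      exact (pow_pos ha0 m).not_ge hq'
    have := norm_pos_iff.2 hq
    have := norm_pos_iff.2 h1
    positivity
  set Z := {q : Fin n → ℤ | ¬ a ^ m ≤ ‖q‖ ^ n * ‖orbitHom A q‖ ^ m} with hZ
  have hZfin : Z.Finite := hev
  obtain ⟨e, he, heZ⟩ : ∃ e > 0, ∀ q ∈ Z \ {0}, e ≤ ‖q‖ ^ n * ‖orbitHom A q‖ ^ m := by
    rcases (Z \ {0}).eq_empty_or_nonempty with h | h
    · exact ⟨1, one_pos, by simp [h]⟩
    · obtain ⟨q₀, hq₀, hmin⟩ := Set.exists_min_image _ (fun q => ‖q‖ ^ n * ‖orbitHom A q‖ ^ m)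
        hZfin.sdiff h
      exact ⟨_, hne q₀ hq₀.2, hmin⟩
  refine ⟨min (min (a ^ m) e) 1, by positivity, min_le_right _ _, fun q hq => ?_⟩
  refine (min_le_left _ _).trans ?_
  by_cases h : q ∈ Z
  · exact (min_le_right _ _).trans (heZ q ⟨h, hq⟩)
  · exact (min_le_left _ _).trans (not_not.1 h)

end BadlyApproximable

/-- Kurzweil's theorem: if `A` is badly approximable, then for any decreasing `ψ`,
the Lebesgue measure of `W_A(ψ)` is `0` or `1` according to convergence or
divergence of `∑_{q ≥ 1} q^{n-1} ψ(q)^m`. -/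
theorem kurzweil (m n : ℕ) (hm : 0 < m) (hn : 0 < n)
    (A : Matrix (Fin m) (Fin n) ℝ) (hA : BadlyApproximable m n A)
    (ψ : ℝ → ℝ) (hψpos : ∀ r : ℝ, 0 < r → 0 < ψ r)
    (hψdec : ∀ x y : ℝ, 0 < x → x ≤ y → ψ y ≤ ψ x) :
    (Summable (fun q : ℕ => ((q : ℝ) + 1) ^ (n - 1) * ψ ((q : ℝ) + 1) ^ m) →
      volume (WA m n A ψ) = 0) ∧
    (¬ Summable (fun q : ℕ => ((q : ℝ) + 1) ^ (n - 1) * ψ ((q : ℝ) + 1) ^ m) →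
      volume (WA m n A ψ) = 1) := by
  obtain ⟨c, hc, hc1, hα⟩ := hA.exists_le hm
  rw [volume_WA]
  exact ⟨volume_approxSet_eq_zero hψpos hψdec,
    volume_approxSet_eq_one hm hn hc hc1 hα hψpos hψdec⟩
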